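/- Assume every vertex of 𝕋 has degree at least 2 (no leaves). Then for every n ∈ ℕ: (i) F_{n+1}^(+) = ker(d_T^(n)) ∩ H^(−) ∩ 𝒜_{n+1} and F_{n+1}^(−) = ker(d_T^(n)) ∩ H^(+) ∩ 𝒜_{n+1}; (ii) U^(n)ψ = ψ for every ψ ∈ F_{n+1}^(+) and U^(n)ψ = −ψ for every ψ ∈ F_{n+1}^(−); (iii) dim F_{n+1}^(+) = dim F_{n+1}^(−) = |V_{n+1}| − |V_n| − 1. -/

import Mathlib

/- Setting: 𝕋 = (V,A) an infinite, locally finite tree. Vertices `V`, arcs = darts of a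
simple graph `G`; `e.fst` = origin, `e.snd` = terminus, `e.symm` = reversed arc.
ℓ²(A) and ℓ²(V) are the `lp _ 2` spaces. The boundary operators, the shift and the
Grover walk are characterized by their pointwise formulas. -/

noncomputable section
open scoped ComplexConjugate ComplexInnerProductSpace Classical
open Complex Filter Topology ContinuousLinearMap

namespace GroverStmt

/-- ℓ²(V) -/
abbrev lV (V : Type) : Type := lp (fun _ : V => ℂ) 2

variable {V : Type} (G : SimpleGraph V)

/-- ℓ²(A) where A is the set of symmetric arcs (darts) of `G`. -/
abbrev lA : Type := lp (fun _ : G.Dart => ℂ) 2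

section deg
variable [∀ v : V, Fintype (G.neighborSet v)]

/-- `(d_T ψ)(u) = Σ_{e : t(e)=u} ψ(e)/√(deg u)` -/
def IsBoundaryT (dT : lA G →L[ℂ] lV V) : Prop :=
  ∀ (ψ : lA G) (u : V),
    dT ψ u = ∑' e : {e : G.Dart // e.snd = u}, ψ e.1 / (Real.sqrt (G.degree u) : ℂ)

/-- `(d_O ψ)(u) = Σ_{e : o(e)=u} ψ(e)/√(deg u)` -/
def IsBoundaryO (dO : lA G →L[ℂ] lV V) : Prop :=
  ∀ (ψ : lA G) (u : V),
    dO ψ u = ∑' e : {e : G.Dart // e.fst = u}, ψ e.1 / (Real.sqrt (G.degree u) : ℂ)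

end deg

/-- `(Sψ)(e) = ψ(ē)` -/
def IsShift (S : lA G →L[ℂ] lA G) : Prop :=
  ∀ (ψ : lA G) (e : G.Dart), S ψ e = ψ e.symm

/-- the Grover walk `U = S (2 d_T* d_T − 1)` -/
def grover (S : lA G →L[ℂ] lA G) (dT : lA G →L[ℂ] lV V) : lA G →L[ℂ] lA G :=
  S ∘L ((2 : ℂ) • ((adjoint dT) ∘L dT) - 1)

variable (o : V)

/-- `v` is a descendant of `u` (w.r.t. the root `o`). -/
def desc (u v : V) : Prop := G.dist o v = G.dist o u + G.dist u v

/-- `e` is an arc pointing away from `u` inside the subtree of descendants of `u`. -/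
def awayIn (u : V) (e : G.Dart) : Prop :=
  desc G o u e.fst ∧ desc G o u e.snd ∧ G.dist u e.fst < G.dist u e.snd

section flows
variable [∀ v : V, Fintype (G.neighborSet v)]

/-- `m(u)`: the number of children of `u`. -/
def m (u : V) : ℕ := if u = o then G.degree u else G.degree u - 1

/-- `En u : Fin (m u) → Dart` is an enumeration `e_0^(u), …, e_{m(u)-1}^(u)` of the arcs
from `u` to its children. -/
def IsChildEnum (En : ∀ u : V, Fin (m G o u) → G.Dart) : Prop :=
  ∀ u : V,
    Function.Injective (En u) ∧
    (∀ k, (En u k).fst = u ∧ G.dist o (En u k).snd = G.dist o u + 1) ∧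
    (∀ e : G.Dart, e.fst = u → G.dist o e.snd = G.dist o u + 1 → ∃ k, En u k = e)

/-- the defining properties of the flow function `φ_{u,j}^(ε) : A → ℂ`. -/
def IsFlow (En : ∀ u : V, Fin (m G o u) → G.Dart)
    (u : V) (j : ℕ) (ε : ℂ) (φ : G.Dart → ℂ) : Prop :=
  (∀ k : Fin (m G o u),
      φ (En u k) =
        Complex.exp (2 * Real.pi * Complex.I * j / (m G o u)) ^ (k : ℕ) / (m G o u)) ∧
  (∀ e : G.Dart, awayIn G o u e → e.fst ≠ u →
     ∀ f : G.Dart, awayIn G o u f → f.snd = e.fst →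
       φ e = ε * φ f / (m G o e.fst)) ∧
  (∀ e : G.Dart, awayIn G o u e → φ e.symm = -ε * φ e) ∧
  (∀ e : G.Dart, ¬(desc G o u e.fst ∧ desc G o u e.snd) → φ e = 0)

end flows


/-- the subspace of ℓ²(A) of functions supported in a set `Aset` of arcs
(for a finite `Aset`, this is the span of the indicators `δ_e`, `e ∈ Aset`). -/
def suppSubmodule (Aset : Set G.Dart) : Submodule ℂ (lA G) where
  carrier := {ψ : lA G | ∀ e ∉ Aset, ψ e = 0}
  add_mem' := by
    intro a b ha hb e he
    rw [lp.coeFn_add, Pi.add_apply, ha e he, hb e he, add_zero]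
  zero_mem' := by
    intro e he
    rw [lp.coeFn_zero, Pi.zero_apply]
  smul_mem' := by
    intro c a ha e he
    rw [lp.coeFn_smul, Pi.smul_apply, ha e he, smul_zero]

section tree

variable {G o}

lemma eq_of_adj_of_dist_add_one (hG : G.IsTree) {p q v : V} (hp : G.Adj p v) (hq : G.Adj q v)
    (hpd : G.dist o v = G.dist o p + 1) (hqd : G.dist o v = G.dist o q + 1) : p = q := by
  obtain ⟨r, hr⟩ := hG.connected.exists_walk_length_eq_dist o p
  obtain ⟨s, hs⟩ := hG.connected.exists_walk_length_eq_dist o q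
  have h1 := (r.concat hp).isPath_of_length_eq_dist (by simp [hr, hpd])
  have h2 := (s.concat hq).isPath_of_length_eq_dist (by simp [hs, hqd])
  have h := congrArg SimpleGraph.Walk.penultimate
    (congrArg Subtype.val ((hG.isAcyclic.subsingleton_path o v).elim ⟨_, h1⟩ ⟨_, h2⟩))
  simpa using h

lemma exists_parent (hG : G.IsTree) {v : V} (hv : v ≠ o) :
    ∃ p, G.Adj p v ∧ G.dist o v = G.dist o p + 1 := by
  obtain ⟨r, hr⟩ := hG.connected.exists_walk_length_eq_dist o v
  have hnil : ¬ r.Nil := SimpleGraph.Walk.not_nil_of_ne hv.symm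
  have hadj := r.adj_penultimate hnil
  refine ⟨r.penultimate, hadj, ?_⟩
  have h1 := SimpleGraph.dist_le r.dropLast
  have h2 := SimpleGraph.Walk.length_dropLast_add_one hnil
  have h3 := hG.dist_eq_dist_add_one_of_adj o hadj
  omega

lemma desc_self (u : V) : desc G o u u := by simp [desc]

lemma desc.eq_of_dist_le (hG : G.IsTree) {u v : V} (h : desc G o u v)
    (hle : G.dist o v ≤ G.dist o u) : v = u := by
  unfold desc at h
  exact ((hG.connected.dist_eq_zero_iff (u := u) (v := v)).1 (by omega)).symm

lemma desc.child (hG : G.IsTree) {u v w : V} (h : desc G o u v) (hvw : G.Adj v w)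
    (hd : G.dist o w = G.dist o v + 1) : desc G o u w := by
  have h1 := hG.dist_eq_dist_add_one_of_adj u hvw
  have h2 := hG.connected.dist_triangle (u := o) (v := u) (w := w)
  unfold desc at *
  omega

lemma desc.parent (hG : G.IsTree) {u v p : V} (h : desc G o u v) (hvu : v ≠ u) (hpv : G.Adj p v)
    (hd : G.dist o v = G.dist o p + 1) : desc G o u p := by
  obtain ⟨q, hqv, hq⟩ := exists_parent (o := u) hG hvu
  have h1 := hG.dist_eq_dist_add_one_of_adj o hqv
  have h2 := hG.connected.dist_triangle (u := o) (v := u) (w := q)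
  unfold desc at *
  obtain rfl : p = q := eq_of_adj_of_dist_add_one hG hpv hqv hd (by omega)
  omega

lemma awayIn_of_desc (hG : G.IsTree) {u : V} {e : G.Dart} (h : desc G o u e.fst)
    (hd : G.dist o e.snd = G.dist o e.fst + 1) : awayIn G o u e := by
  have h' := h.child hG e.adj hd
  refine ⟨h, h', ?_⟩
  unfold desc at *
  omega

lemma finite_ball [∀ v : V, Fintype (G.neighborSet v)] (hG : G.IsTree) (n : ℕ) :
    {v : V | G.dist o v ≤ n}.Finite := by
  induction n with
  | zero =>
    refine (Set.finite_singleton o).subset fun v hv => ?_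
    simpa [hG.connected.dist_eq_zero_iff, eq_comm] using hv
  | succ n ih =>
    refine ((Set.finite_singleton o).union
      (ih.biUnion fun v _ => (G.neighborSet v).toFinite)).subset fun v hv => ?_
    rcases eq_or_ne v o with rfl | hvo
    · simp
    · obtain ⟨p, hp, hd⟩ := exists_parent hG hvo
      simp only [Set.mem_ofPred_eq, Set.mem_union, Set.mem_iUnion] at hv ⊢
      exact Or.inr ⟨p, by omega, hp⟩

lemma finite_darts [∀ v : V, Fintype (G.neighborSet v)] (hG : G.IsTree) (n : ℕ) :
    {e : G.Dart | G.dist o e.fst ≤ n ∧ G.dist o e.snd ≤ n}.Finite := by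
  refine Set.Finite.of_finite_image (f := SimpleGraph.Dart.toProd)
    (((finite_ball (o := o) hG n).prod (finite_ball (o := o) hG n)).subset ?_)
    (SimpleGraph.Dart.toProd_injective.injOn)
  rintro _ ⟨e, he, rfl⟩
  exact he

lemma dist_le_of_fst_or_snd (hG : G.IsTree) {n : ℕ} {v : V} (hv : G.dist o v ≤ n) (e : G.Dart)
    (he : e.fst = v ∨ e.snd = v) : G.dist o e.fst ≤ n + 1 ∧ G.dist o e.snd ≤ n + 1 := by
  have := hG.dist_eq_dist_add_one_of_adj o e.adj
  rcases he with rfl | rfl <;> omega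

end tree

section enum

variable {G o} [∀ v : V, Fintype (G.neighborSet v)] {En : ∀ u : V, Fin (m G o u) → G.Dart}

lemma tsum_incoming_of_parent_eq_zero (hG : G.IsTree) (hEn : IsChildEnum G o En) (v : V)
    (f : G.Dart → ℂ)
    (hf : ∀ e : G.Dart, e.snd = v → G.dist o v = G.dist o e.fst + 1 → f e = 0) :
    ∑' e : {e : G.Dart // e.snd = v}, f e.1 = ∑ k, f (En v k).symm := by
  let g : Fin (m G o v) → {e : G.Dart // e.snd = v} :=
    fun k => ⟨(En v k).symm, ((hEn v).2.1 k).1⟩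
  have hg : Function.Injective g := fun a b hab =>
    (hEn v).1 (SimpleGraph.Dart.symm_involutive.injective (congrArg Subtype.val hab))
  rw [← tsum_fintype (L := .unconditional _),
    ← hg.tsum_eq (f := fun e : {e : G.Dart // e.snd = v} => f e.1)]
  rintro ⟨e, rfl⟩ he
  rcases hG.dist_eq_dist_add_one_of_adj o e.adj with h | h
  · obtain ⟨k, hk⟩ := (hEn e.snd).2.2 e.symm rfl h
    exact ⟨k, Subtype.ext (by simp [g, hk])⟩
  · exact absurd (hf e rfl h) he

lemma tsum_incoming (hG : G.IsTree) (hEn : IsChildEnum G o En) {p : G.Dart}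
    (hp : G.dist o p.snd = G.dist o p.fst + 1) (f : G.Dart → ℂ) :
    ∑' e : {e : G.Dart // e.snd = p.snd}, f e.1 = f p + ∑ k, f (En p.snd k).symm := by
  let g : Option (Fin (m G o p.snd)) → {e : G.Dart // e.snd = p.snd} :=
    fun k => k.elim ⟨p, rfl⟩ fun k => ⟨(En p.snd k).symm, ((hEn p.snd).2.1 k).1⟩
  have hne (k) : p ≠ (En p.snd k).symm := fun h => by
    have h1 := ((hEn p.snd).2.1 k).2
    have h2 := congrArg (fun e : G.Dart => e.fst) h
    simp only [SimpleGraph.Dart.symm_toProd, Prod.fst_swap] at h2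
    rw [← h2] at h1
    omega
  have hg : Function.Injective g := by
    rintro (_ | a) (_ | b) hab
    · rfl
    · exact absurd (congrArg Subtype.val hab) (hne b)
    · exact absurd (congrArg Subtype.val hab).symm (hne a)
    · exact congrArg some
        ((hEn _).1 (SimpleGraph.Dart.symm_involutive.injective (congrArg Subtype.val hab)))
  have := Fintype.sum_option fun k => f (g k).1
  refine Eq.trans ?_ this
  rw [← tsum_fintype (L := .unconditional _),
    ← hg.tsum_eq (f := fun e : {e : G.Dart // e.snd = p.snd} => f e.1)]
  rintro ⟨e, he'⟩ -
  rcases hG.dist_eq_dist_add_one_of_adj o e.adj with h | h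
  · obtain ⟨k, hk⟩ := (hEn p.snd).2.2 e.symm he' (by rw [← he']; exact h)
    exact ⟨some k, Subtype.ext (by simp [g, hk])⟩
  · refine ⟨none, Subtype.ext ?_⟩
    have : p.fst = e.fst := eq_of_adj_of_dist_add_one (o := o) hG p.adj (he' ▸ e.adj) hp
      (by rw [← he']; exact h)
    exact SimpleGraph.Dart.ext _ _ (Prod.ext this he'.symm)

lemma one_le_m (hdeg : ∀ v : V, 2 ≤ G.degree v) (u : V) : 1 ≤ m G o u := by
  have := hdeg u
  unfold m
  split_ifs <;> omega

/-- Every vertex other than the root is the terminus of exactly one child arc. -/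
lemma card_children (hG : G.IsTree) (hEn : IsChildEnum G o En) (n : ℕ) :
    Nat.card (Σ u : {v : V // G.dist o v ≤ n}, Fin (m G o u.1)) + 1 =
      Nat.card {v : V // G.dist o v ≤ n + 1} := by
  have : Finite {v : V // G.dist o v ≤ n} := finite_ball hG n
  have : Finite {v : V // G.dist o v ≤ n + 1} := finite_ball hG (n + 1)
  rw [← Finite.card_option]
  refine Nat.card_congr (Equiv.ofBijective (fun x : Option _ => x.elim ⟨o, by simp⟩ fun i =>
    ⟨(En i.1.1 i.2).snd, by rw [((hEn i.1.1).2.1 i.2).2]; have := i.1.2; omega⟩) ⟨?_, ?_⟩)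
  · have hne (u k) : (En u k).snd ≠ o := fun h => by
      have := ((hEn u).2.1 k).2
      simp [h] at this
    rintro (_ | ⟨⟨u, hu⟩, k⟩) (_ | ⟨⟨v, hv⟩, l⟩) h
    · rfl
    · exact absurd (congrArg Subtype.val h).symm (hne v l)
    · exact absurd (congrArg Subtype.val h) (hne u k)
    · have h' : (En u k).snd = (En v l).snd := congrArg Subtype.val h
      obtain ⟨h1, h2⟩ := (hEn u).2.1 k
      obtain ⟨h3, h4⟩ := (hEn v).2.1 l
      have huv : (En u k).fst = (En v l).fst :=
        eq_of_adj_of_dist_add_one (o := o) hG (En u k).adj (h' ▸ (En v l).adj) (by rw [h2, h1])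
          (by rw [h', h4, h3])
      obtain rfl : u = v := by rw [← h1, huv, h3]
      obtain rfl := (hEn u).1 (SimpleGraph.Dart.ext _ _ (Prod.ext huv h'))
      rfl
  · rintro ⟨v, hv⟩
    rcases eq_or_ne v o with rfl | hvo
    · exact ⟨none, rfl⟩
    · obtain ⟨p, hp, hd⟩ := exists_parent hG hvo
      obtain ⟨k, hk⟩ := (hEn p).2.2 ⟨(p, v), hp⟩ rfl hd
      exact ⟨some ⟨⟨p, by omega⟩, k⟩, Subtype.ext (by simp [hk])⟩

end enum

lemma exp_eq_pow (j M : ℕ) : Complex.exp (2 * Real.pi * Complex.I * j / M) =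
    Complex.exp (2 * Real.pi * Complex.I / M) ^ j := by
  rw [← Complex.exp_nat_mul]
  ring_nf

lemma sum_root_div {M : ℕ} {ζ : ℂ} (hζ : IsPrimitiveRoot ζ M) (k l : Fin M) :
    ∑ j ∈ Finset.range M, (ζ ^ j) ^ (k : ℕ) / (ζ ^ j) ^ (l : ℕ) = if k = l then (M : ℂ) else 0 := by
  have hM : M ≠ 0 := (Fin.pos k).ne'
  have hζ0 : ζ ≠ 0 := hζ.ne_zero hM
  have hz : ∀ j, (ζ ^ j) ^ (k : ℕ) / (ζ ^ j) ^ (l : ℕ) = (ζ ^ (k : ℕ) / ζ ^ (l : ℕ)) ^ j := by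
    intro j
    rw [div_pow, ← pow_mul, ← pow_mul, ← pow_mul, ← pow_mul, mul_comm, mul_comm j]
  simp only [hz]
  split_ifs with h
  · simp [h, hζ0]
  · have h1 : ζ ^ (k : ℕ) / ζ ^ (l : ℕ) ≠ 1 := fun h1 => by
      rw [div_eq_one_iff_eq (pow_ne_zero _ hζ0)] at h1
      exact h (Fin.ext (hζ.pow_inj k.2 l.2 h1))
    rw [geom_sum_eq h1, div_pow, ← pow_mul, ← pow_mul, mul_comm, pow_mul, mul_comm (l : ℕ), pow_mul,
      hζ.pow_eq_one]
    simp

/-- Discrete Fourier inversion for a vector of zero mean. -/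
lemma exists_fourier_coeff {M : ℕ} (a : Fin M → ℂ) (ha : ∑ k, a k = 0) :
    ∃ c : ℕ → ℂ, ∀ k : Fin M, a k = ∑ j ∈ Finset.Icc 1 (M - 1),
      c j * (Complex.exp (2 * Real.pi * Complex.I * j / M) ^ (k : ℕ) / M) := by
  rcases Nat.eq_zero_or_pos M with rfl | hM
  · exact ⟨0, fun k => k.elim0⟩
  have hζ := Complex.isPrimitiveRoot_exp M hM.ne'
  set ζ := Complex.exp (2 * Real.pi * Complex.I / M) with hζd
  have hM0 : (M : ℂ) ≠ 0 := by exact_mod_cast hM.ne'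
  refine ⟨fun j => ∑ l, a l / (ζ ^ j) ^ (l : ℕ), fun k => ?_⟩
  simp only [exp_eq_pow, ← hζd]
  have hIcc : Finset.range M = insert 0 (Finset.Icc 1 (M - 1)) := by
    ext j; simp; omega
  have h0 : ∑ j ∈ Finset.range M, (∑ l, a l / (ζ ^ j) ^ (l : ℕ)) * ((ζ ^ j) ^ (k : ℕ) / M) = a k := by
    calc _ = ∑ l, a l / M * ∑ j ∈ Finset.range M, (ζ ^ j) ^ (k : ℕ) / (ζ ^ j) ^ (l : ℕ) := by
          simp only [Finset.sum_mul, Finset.mul_sum]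
          rw [Finset.sum_comm]
          refine Finset.sum_congr rfl fun l _ => Finset.sum_congr rfl fun j _ => ?_
          ring
      _ = a k := by
          simp only [sum_root_div hζ]
          simp [hM0]
  rw [← h0, hIcc, Finset.sum_insert (by simp)]
  simp [ha]

lemma sum_root_eq_zero {M j : ℕ} (hj : 1 ≤ j) (hjM : j ≤ M - 1) :
    ∑ k : Fin M, Complex.exp (2 * Real.pi * Complex.I * j / M) ^ (k : ℕ) / M = 0 := by
  have hζ := Complex.isPrimitiveRoot_exp M (by omega)
  have h1 : Complex.exp (2 * Real.pi * Complex.I / M) ^ j ≠ 1 :=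
    hζ.pow_ne_one_of_pos_of_lt (by omega) (by omega)
  rw [← Finset.sum_div, Fin.sum_univ_eq_sum_range
    (fun k => Complex.exp (2 * Real.pi * Complex.I * j / M) ^ k) M, exp_eq_pow, geom_sum_eq h1,
    ← pow_mul, mul_comm j, pow_mul, hζ.pow_eq_one]
  simp

section flow

variable {G o} [∀ v : V, Fintype (G.neighborSet v)] {En : ∀ u : V, Fin (m G o u) → G.Dart}
  {u : V} {j : ℕ} {ε : ℂ} {φ : G.Dart → ℂ}

lemma IsFlow.symm (hG : G.IsTree) (hε : ε * ε = 1) (h : IsFlow G o En u j ε φ) (e : G.Dart) :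
    φ e.symm = -ε * φ e := by
  by_cases hd : desc G o u e.fst ∧ desc G o u e.snd
  · rcases hG.dist_eq_dist_add_one_of_adj o e.adj with hl | hl
    · have := h.2.2.1 e.symm (awayIn_of_desc hG hd.2 hl)
      rw [SimpleGraph.Dart.symm_symm] at this
      linear_combination ε * this - φ e.symm * hε
    · exact h.2.2.1 e (awayIn_of_desc hG hd.1 hl)
  · rw [h.2.2.2 e hd, h.2.2.2 e.symm fun hd' => hd hd'.symm, mul_zero]

lemma IsFlow.apply_child_eq_zero (hG : G.IsTree) (h : IsFlow G o En u j ε φ) {e : G.Dart}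
    (he : e.fst ≠ u) (hle : G.dist o e.fst ≤ G.dist o u) : φ e = 0 :=
  h.2.2.2 e fun hd => he (hd.1.eq_of_dist_le hG hle)

lemma IsFlow.tsum_incoming_eq_zero (hG : G.IsTree) (hdeg : ∀ v : V, 2 ≤ G.degree v)
    (hEn : IsChildEnum G o En) (hε : ε * ε = 1) (hj : 1 ≤ j) (hjm : j ≤ m G o u - 1)
    (h : IsFlow G o En u j ε φ) (v : V) :
    ∑' e : {e : G.Dart // e.snd = v}, φ e.1 = 0 := by
  by_cases hd : desc G o u v
  · rcases eq_or_ne v u with rfl | hvu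
    · rw [tsum_incoming_of_parent_eq_zero hG hEn]
      · simp only [h.symm hG hε, h.1]
        rw [← Finset.mul_sum, sum_root_eq_zero hj hjm, mul_zero]
      · rintro e rfl he
        refine h.2.2.2 e fun hd' => ?_
        have := hd'.1
        unfold desc at this
        omega
    · have hvo : v ≠ o := by
        rintro rfl
        exact hvu (hd.eq_of_dist_le hG (by simp))
      obtain ⟨q, hq, hl⟩ := exists_parent hG hvo
      let p : G.Dart := ⟨(q, v), hq⟩
      have hp : awayIn G o u p := awayIn_of_desc hG (hd.parent hG hvu hq hl) hl
      have hm : (m G o v : ℂ) ≠ 0 := by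
        have := one_le_m (o := o) hdeg v
        exact_mod_cast (by omega : m G o v ≠ 0)
      have hk (k) : φ (En v k).symm = -φ p / m G o v := by
        obtain ⟨h1, h2⟩ := (hEn v).2.1 k
        have ha : awayIn G o u (En v k) := awayIn_of_desc hG (by rwa [h1]) (by rw [h2, h1])
        rw [h.symm hG hε, h.2.1 _ ha (by rwa [h1]) p hp h1.symm, h1]
        linear_combination (-φ p / m G o v) * hε
      have := tsum_incoming hG hEn (p := p) hl φ
      refine this.trans ?_
      change φ p + ∑ k, φ (En v k).symm = 0
      simp only [hk, Finset.sum_const, Finset.card_univ, Fintype.card_fin, nsmul_eq_mul]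
      field_simp
      ring
  · have (e : {e : G.Dart // e.snd = v}) : φ e.1 = 0 :=
      h.2.2.2 _ fun hd' => hd (e.2 ▸ hd'.2)
    simp [this]

end flow

/-- The functions with `ψ(ē) = -ε ψ(e)`. -/
def skewSubmodule (ε : ℂ) : Submodule ℂ (lA G) where
  carrier := {ψ : lA G | ∀ e : G.Dart, ψ e.symm = -ε * ψ e}
  add_mem' := by
    intro a b ha hb e
    rw [lp.coeFn_add, Pi.add_apply, Pi.add_apply, ha e, hb e, mul_add]
  zero_mem' := by
    intro e
    rw [lp.coeFn_zero, Pi.zero_apply, Pi.zero_apply, mul_zero]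
  smul_mem' := by
    intro c a ha e
    rw [lp.coeFn_smul, Pi.smul_apply, Pi.smul_apply, ha e, smul_eq_mul, smul_eq_mul,
      mul_left_comm]

/-- `ker T ∩ {ψ(ē) = -ε ψ(e)} ∩ {supp ψ ⊆ A}`. -/
def birthSpace (T : lA G →L[ℂ] lV V) (ε : ℂ) (A : Set G.Dart) : Submodule ℂ (lA G) :=
  LinearMap.ker T.toLinearMap ⊓ (skewSubmodule G ε ⊓ suppSubmodule G A)

lemma exists_lA_of_finite {A : Set G.Dart} (hA : A.Finite) (f : G.Dart → ℂ) :
    ∃ ψ : lA G, ∀ e, ψ e = if e ∈ A then f e else 0 := by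
  have h : Memℓp (fun e => if e ∈ A then f e else 0 : ∀ _ : G.Dart, ℂ) 2 :=
    (memℓp_zero (hA.subset fun e he => by by_contra h; simp [h] at he)).of_exponent_ge zero_le
  exact ⟨⟨_, h⟩, fun e => rfl⟩

section truncated

variable {G o} [∀ v : V, Fintype (G.neighborSet v)] {En : ∀ u : V, Fin (m G o u) → G.Dart}

lemma apply_eq_zero_iff (hdeg : ∀ v : V, 2 ≤ G.degree v) {dT : lA G →L[ℂ] lV V}
    (hdT : IsBoundaryT G dT) {n : ℕ} {Q : lV V →L[ℂ] lV V}
    (hQ : ∀ (f : lV V) (v : V),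
      (G.dist o v ≤ n → Q f v = f v) ∧ (¬ G.dist o v ≤ n → Q f v = 0)) (ψ : lA G) :
    (Q ∘L dT) ψ = 0 ↔
      ∀ v, G.dist o v ≤ n → ∑' e : {e : G.Dart // e.snd = v}, ψ e.1 = 0 := by
  have key (v : V) : dT ψ v = 0 ↔ ∑' e : {e : G.Dart // e.snd = v}, ψ e.1 = 0 := by
    have hs : (Real.sqrt (G.degree v) : ℂ) ≠ 0 := by
      have : 0 < (G.degree v : ℝ) := by have := hdeg v; exact_mod_cast (by omega)
      exact_mod_cast (Real.sqrt_pos.2 this).ne'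
    rw [hdT, tsum_div_const, div_eq_zero_iff, or_iff_left hs]
  constructor
  · intro h v hv
    rw [← key, ← (hQ _ v).1 hv]
    exact congrArg (fun f : lV V => f v) h
  · intro h
    ext v
    by_cases hv : G.dist o v ≤ n
    · exact ((hQ _ v).1 hv).trans ((key v).2 (h v hv))
    · exact (hQ _ v).2 hv

lemma truncatedFlow_mem_birthSpace (hG : G.IsTree) (hdeg : ∀ v : V, 2 ≤ G.degree v)
    (hEn : IsChildEnum G o En) {dT : lA G →L[ℂ] lV V} (hdT : IsBoundaryT G dT) {n : ℕ}
    {Q : lV V →L[ℂ] lV V} (hQ : ∀ (f : lV V) (v : V),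
      (G.dist o v ≤ n → Q f v = f v) ∧ (¬ G.dist o v ≤ n → Q f v = 0))
    {ε : ℂ} (hε : ε * ε = 1) {A : Set G.Dart}
    (hA : A = {e : G.Dart | G.dist o e.fst ≤ n + 1 ∧ G.dist o e.snd ≤ n + 1})
    {u : V} {j : ℕ} (hj : 1 ≤ j) (hjm : j ≤ m G o u - 1) {φ : G.Dart → ℂ}
    (hφ : IsFlow G o En u j ε φ) {ψ : lA G} (hψ : ∀ e, ψ e = if e ∈ A then φ e else 0) :
    ψ ∈ birthSpace G (Q ∘L dT) ε A := by
  refine ⟨?_, fun e => ?_, fun e he => by rw [hψ, if_neg he]⟩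
  · refine (apply_eq_zero_iff hdeg hdT hQ ψ).2 fun v hv => ?_
    rw [← hφ.tsum_incoming_eq_zero hG hdeg hEn hε hj hjm v]
    refine tsum_congr fun e => ?_
    rw [hψ, if_pos]
    rw [hA]
    exact dist_le_of_fst_or_snd hG hv e.1 (Or.inr e.2)
  · have : e.symm ∈ A ↔ e ∈ A := by
      rw [hA]
      exact and_comm
    simp only [hψ, this, hφ.symm hG hε]
    split_ifs <;> simp

lemma eq_zero_of_child_eq_zero (hG : G.IsTree) (hEn : IsChildEnum G o En) {n : ℕ} {ε : ℂ}
    {A : Set G.Dart}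
    (hA : A = {e : G.Dart | G.dist o e.fst ≤ n + 1 ∧ G.dist o e.snd ≤ n + 1})
    {ψ : lA G} (hskew : ψ ∈ skewSubmodule G ε) (hsupp : ψ ∈ suppSubmodule G A)
    (h0 : ∀ v k, G.dist o v ≤ n → ψ (En v k) = 0) : ψ = 0 := by
  ext e
  by_cases he : e ∈ A
  · have he' := he
    rw [hA] at he'
    obtain ⟨h1, h2⟩ := he'
    rcases hG.dist_eq_dist_add_one_of_adj o e.adj with hl | hl
    · obtain ⟨k, hk⟩ := (hEn e.snd).2.2 e.symm rfl hl
      have := hskew e.symm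
      rw [SimpleGraph.Dart.symm_symm, ← hk, h0 _ _ (by omega), mul_zero] at this
      exact this
    · obtain ⟨k, hk⟩ := (hEn e.fst).2.2 e rfl hl
      have := h0 e.fst k (by omega)
      rw [hk] at this
      exact this
  · exact hsupp e he

lemma mem_span_truncatedFlow (hG : G.IsTree) (hdeg : ∀ v : V, 2 ≤ G.degree v)
    (hEn : IsChildEnum G o En) {dT : lA G →L[ℂ] lV V} (hdT : IsBoundaryT G dT) {n : ℕ}
    {Q : lV V →L[ℂ] lV V} (hQ : ∀ (f : lV V) (v : V),
      (G.dist o v ≤ n → Q f v = f v) ∧ (¬ G.dist o v ≤ n → Q f v = 0))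
    {ε : ℂ} (hε : ε * ε = 1) {A : Set G.Dart}
    (hA : A = {e : G.Dart | G.dist o e.fst ≤ n + 1 ∧ G.dist o e.snd ≤ n + 1})
    {φ : V → ℕ → G.Dart → ℂ}
    (hφ : ∀ u j, 1 ≤ j → j ≤ m G o u - 1 → IsFlow G o En u j ε (φ u j))
    {t : V → ℕ → lA G} (ht : ∀ u j e, t u j e = if e ∈ A then φ u j e else 0)
    {F : Submodule ℂ (lA G)}
    (hF : ∀ u j, G.dist o u ≤ n → 1 ≤ j → j ≤ m G o u - 1 → t u j ∈ F)
    (d : ℕ) : ∀ r, r + d = n + 1 → ∀ ψ ∈ birthSpace G (Q ∘L dT) ε A,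
      (∀ v k, G.dist o v < r → ψ (En v k) = 0) → ψ ∈ F := by
  induction d with
  | zero =>
    intro r hr ψ hψ h0
    rw [eq_zero_of_child_eq_zero hG hEn hA hψ.2.1 hψ.2.2 fun v k hv => h0 v k (by omega)]
    exact F.zero_mem
  | succ d ih =>
    intro r hr ψ hψ h0
    have hsum (u : V) (hu : G.dist o u = r) : ∑ k, ψ (En u k) = 0 := by
      have h := (apply_eq_zero_iff hdeg hdT hQ ψ).1 hψ.1 u (by omega)
      rw [tsum_incoming_of_parent_eq_zero hG hEn] at h
      · simp only [hψ.2.1 (En u _), ← Finset.mul_sum] at h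
        linear_combination -ε * h - (∑ k, ψ (En u k)) * hε
      · rintro e rfl he
        obtain ⟨k, hk⟩ := (hEn e.fst).2.2 e rfl he
        have := h0 e.fst k (by omega)
        rwa [hk] at this
    have hc (u : V) : ∃ c : ℕ → ℂ, G.dist o u = r → ∀ k : Fin (m G o u),
        ψ (En u k) = ∑ j ∈ Finset.Icc 1 (m G o u - 1),
          c j * (Complex.exp (2 * Real.pi * Complex.I * j / m G o u) ^ (k : ℕ) / m G o u) := by
      by_cases hu : G.dist o u = r
      · obtain ⟨c, hc⟩ := exists_fourier_coeff _ (hsum u hu)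
        exact ⟨c, fun _ => hc⟩
      · exact ⟨0, fun h => absurd h hu⟩
    choose c hc using hc
    have hB : {u : V | G.dist o u = r}.Finite :=
      (finite_ball (o := o) hG r).subset fun u hu => le_of_eq hu
    let χ : lA G := ∑ u ∈ hB.toFinset, ∑ j ∈ Finset.Icc 1 (m G o u - 1), c u j • t u j
    have hterm {W : Submodule ℂ (lA G)}
        (hW : ∀ u j, G.dist o u ≤ n → 1 ≤ j → j ≤ m G o u - 1 → t u j ∈ W) : χ ∈ W := by
      refine W.sum_mem fun u hu => W.sum_mem fun j hj => W.smul_mem _ (hW u j ?_ ?_ ?_)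
      · rw [Set.Finite.mem_toFinset] at hu
        exact (le_of_eq hu).trans (by omega)
      · exact (Finset.mem_Icc.1 hj).1
      · exact (Finset.mem_Icc.1 hj).2
    have hχK : χ ∈ birthSpace G (Q ∘L dT) ε A := hterm fun u j _ hj hjm =>
      truncatedFlow_mem_birthSpace hG hdeg hEn hdT hQ hε hA hj hjm (hφ u j hj hjm) (ht u j)
    have hχ (e : G.Dart) : χ e =
        ∑ u ∈ hB.toFinset, ∑ j ∈ Finset.Icc 1 (m G o u - 1), c u j * t u j e := by
      simp only [χ, lp.coeFn_sum, Finset.sum_apply, lp.coeFn_smul, Pi.smul_apply, smul_eq_mul]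
    rw [← sub_add_cancel ψ χ]
    refine F.add_mem (ih (r + 1) (by omega) _ (Submodule.sub_mem _ hψ hχK) fun v k hv => ?_)
      (hterm hF)
    obtain ⟨h1, h2⟩ := (hEn v).2.1 k
    have heA : En v k ∈ A := by
      rw [hA]
      exact dist_le_of_fst_or_snd hG (by omega : G.dist o v ≤ n) _ (Or.inl h1)
    have hne (u : V) (hu : u ∈ hB.toFinset) (huv : u ≠ v) :
        ∑ j ∈ Finset.Icc 1 (m G o u - 1), c u j * t u j (En v k) = 0 := by
      refine Finset.sum_eq_zero fun j hj => ?_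
      rw [Finset.mem_Icc] at hj
      have hu' : G.dist o u = r := by simpa using hu
      rw [ht, if_pos heA, (hφ u j hj.1 hj.2).apply_child_eq_zero hG (by rw [h1]; exact huv.symm)
        (by rw [h1]; omega), mul_zero]
    rw [lp.coeFn_sub, Pi.sub_apply, hχ, sub_eq_zero]
    rcases (show G.dist o v < r ∨ G.dist o v = r by omega) with hvr | hvr
    · rw [h0 v k hvr, Finset.sum_eq_zero]
      refine fun u hu => hne u hu ?_
      rintro rfl
      have hu' : G.dist o u = r := by simpa using hu
      omega
    · rw [Finset.sum_eq_single v hne (fun h => absurd (by simpa using hvr) h), hc v hvr k]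
      refine Finset.sum_congr rfl fun j hj => ?_
      rw [Finset.mem_Icc] at hj
      rw [ht, if_pos heA, (hφ v j hj.1 hj.2).1]

/-- The dimension of the birth space is at least the number of edges minus the number of
constraints. -/
lemma card_le_finrank_birthSpace (hG : G.IsTree) (hEn : IsChildEnum G o En)
    {T : lA G →L[ℂ] lV V} {n : ℕ} (hT : ∀ ψ v, ¬ G.dist o v ≤ n → T ψ v = 0)
    {ε : ℂ} (hε : ε * ε = 1) {A : Set G.Dart}
    (hA : A = {e : G.Dart | G.dist o e.fst ≤ n + 1 ∧ G.dist o e.snd ≤ n + 1})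
    [FiniteDimensional ℂ (birthSpace G T ε A)] :
    Nat.card (Σ u : {v : V // G.dist o v ≤ n}, Fin (m G o u.1)) ≤
      Module.finrank ℂ (birthSpace G T ε A) + Nat.card {v : V // G.dist o v ≤ n} := by
  have : Fintype {v : V // G.dist o v ≤ n} := (finite_ball hG n).fintype
  let ι := Σ u : {v : V // G.dist o v ≤ n}, Fin (m G o u.1)
  let E : ι → G.Dart := fun i => En i.1.1 i.2
  have hEfst (i : ι) : (E i).fst = i.1.1 := ((hEn i.1.1).2.1 i.2).1
  have hEsnd (i : ι) : G.dist o (E i).snd = G.dist o (E i).fst + 1 := by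
    rw [hEfst]
    exact ((hEn i.1.1).2.1 i.2).2
  have hEinj : Function.Injective E := by
    rintro ⟨⟨u, hu⟩, k⟩ ⟨⟨v, hv⟩, l⟩ h
    have huv : u = v := (hEfst ⟨⟨u, hu⟩, k⟩).symm.trans
      ((congrArg (fun e : G.Dart => e.fst) h).trans (hEfst ⟨⟨v, hv⟩, l⟩))
    subst huv
    obtain rfl := (hEn u).1 h
    rfl
  have hEsymm (i i' : ι) : E i ≠ (E i').symm := fun h => by
    have h1 := hEsnd i
    have h2 := hEsnd i'
    rw [h] at h1
    simp only [SimpleGraph.Dart.symm_toProd, Prod.fst_swap, Prod.snd_swap] at h1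
    omega
  let b : ι → lA G := fun i => lp.single 2 (E i) 1 - ε • lp.single 2 (E i).symm 1
  have hb (i : ι) (e : G.Dart) :
      b i e = (if e = E i then 1 else 0) - ε * (if e = (E i).symm then 1 else 0) := by
    simp only [b, lp.coeFn_sub, lp.coeFn_smul, Pi.sub_apply, Pi.smul_apply, smul_eq_mul,
      lp.single_apply, Pi.single_apply]
  have hbmem (i : ι) : b i ∈ skewSubmodule G ε ⊓ suppSubmodule G A := by
    refine ⟨fun e => ?_, fun e he => ?_⟩
    · have h1 : e.symm = E i ↔ e = (E i).symm := SimpleGraph.Dart.symm_involutive.eq_iff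
      have h2 : e.symm = (E i).symm ↔ e = E i := SimpleGraph.Dart.symm_involutive.injective.eq_iff
      rw [hb, hb]
      simp only [h1, h2]
      linear_combination -(if e = (E i).symm then (1 : ℂ) else 0) * hε
    · have hi := dist_le_of_fst_or_snd hG i.1.2 (E i) (Or.inl (hEfst i))
      rw [hb, if_neg, if_neg]
      · simp
      · rintro rfl
        exact he (by rw [hA]; exact hi.symm)
      · rintro rfl
        exact he (by rw [hA]; exact hi)
  let L : (ι → ℂ) →ₗ[ℂ] lA G := Fintype.linearCombination ℂ b
  have hL (g : ι → ℂ) (i : ι) : L g (E i) = g i := by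
    simp only [L, Fintype.linearCombination_apply, lp.coeFn_sum, Finset.sum_apply, lp.coeFn_smul,
      Pi.smul_apply, smul_eq_mul, hb, hEsymm, if_false, hEinj.eq_iff]
    rw [Finset.sum_eq_single i (fun i' _ hi' => by simp [hi'.symm]) (by simp)]
    simp
  have hLinj : Function.Injective L := fun g g' h => funext fun i => by rw [← hL g, h, hL]
  let R : (ι → ℂ) →ₗ[ℂ] ({v : V // G.dist o v ≤ n} → ℂ) :=
    { toFun := fun g v => T (L g) v.1
      map_add' := fun g g' => by ext v; simp
      map_smul' := fun a g => by ext v; simp }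
  have hker (g : LinearMap.ker R) : L g.1 ∈ birthSpace G T ε A := by
    refine ⟨?_, ?_⟩
    · change T (L g.1) = 0
      ext v
      by_cases hv : G.dist o v ≤ n
      · exact congrFun (LinearMap.mem_ker.1 g.2) ⟨v, hv⟩
      · exact hT _ v hv
    · simp only [L, Fintype.linearCombination_apply]
      exact Submodule.sum_mem _ fun i _ => Submodule.smul_mem _ _ (hbmem i)
  have h1 : Module.finrank ℂ (LinearMap.ker R) ≤ Module.finrank ℂ (birthSpace G T ε A) :=
    LinearMap.finrank_le_finrank_of_injective
      (f := (L.domRestrict (LinearMap.ker R)).codRestrict (birthSpace G T ε A) hker)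
      fun g g' h => Subtype.ext (hLinj (congrArg Subtype.val h))
  have h2 := R.finrank_range_add_finrank_ker
  have h3 := Submodule.finrank_le (LinearMap.range R)
  rw [Module.finrank_fintype_fun_eq_card] at h2 h3
  rw [Nat.card_eq_fintype_card, Nat.card_eq_fintype_card]
  change Fintype.card ι ≤ _
  omega

/-- The truncated flows span the birth space, whose dimension is `|V_{n+1}| - |V_n| - 1`. -/
lemma span_truncatedFlow (hG : G.IsTree) (hdeg : ∀ v : V, 2 ≤ G.degree v)
    (hEn : IsChildEnum G o En) {dT : lA G →L[ℂ] lV V} (hdT : IsBoundaryT G dT) {n : ℕ}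
    {Q : lV V →L[ℂ] lV V} (hQ : ∀ (f : lV V) (v : V),
      (G.dist o v ≤ n → Q f v = f v) ∧ (¬ G.dist o v ≤ n → Q f v = 0))
    {ε : ℂ} (hε : ε * ε = 1) {A : Set G.Dart}
    (hA : A = {e : G.Dart | G.dist o e.fst ≤ n + 1 ∧ G.dist o e.snd ≤ n + 1})
    {φ : V → ℕ → G.Dart → ℂ}
    (hφ : ∀ u j, 1 ≤ j → j ≤ m G o u - 1 → IsFlow G o En u j ε (φ u j))
    {F : Submodule ℂ (lA G)}
    (hF : F = Submodule.span ℂ {ψ : lA G | ∃ (u : V) (j : ℕ), G.dist o u ≤ n ∧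
      1 ≤ j ∧ j ≤ m G o u - 1 ∧ ∀ e : G.Dart, ψ e = if e ∈ A then φ u j e else 0}) :
    F = birthSpace G (Q ∘L dT) ε A ∧
      Module.finrank ℂ F =
        Nat.card {v : V // G.dist o v ≤ n + 1} - Nat.card {v : V // G.dist o v ≤ n} - 1 := by
  have hAfin : A.Finite := hA ▸ finite_darts hG (n + 1)
  choose t ht using fun u j => exists_lA_of_finite G hAfin (φ u j)
  have hFK : F = birthSpace G (Q ∘L dT) ε A := by
    refine le_antisymm ?_ fun ψ hψ => ?_
    · rw [hF, Submodule.span_le]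
      rintro ψ ⟨u, j, -, hj, hjm, hψ⟩
      exact truncatedFlow_mem_birthSpace hG hdeg hEn hdT hQ hε hA hj hjm (hφ u j hj hjm) hψ
    · refine mem_span_truncatedFlow hG hdeg hEn hdT hQ hε hA hφ ht (fun u j hu hj hjm => ?_)
        (n + 1) 0 (zero_add _) ψ hψ (fun v k hv => absurd hv (Nat.not_lt_zero _))
      rw [hF]
      exact Submodule.subset_span ⟨u, j, hu, hj, hjm, ht u j⟩
  refine ⟨hFK, ?_⟩
  have : Fintype {v : V // G.dist o v ≤ n} := (finite_ball hG n).fintype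
  let t' : (Σ u : {v : V // G.dist o v ≤ n}, Fin (m G o u.1 - 1)) → lA G :=
    fun i => t i.1.1 (i.2 + 1)
  have hF' : F = Submodule.span ℂ (Set.range t') := by
    rw [hF]
    congr 1
    ext ψ
    constructor
    · rintro ⟨u, j, hu, hj, hjm, hψ⟩
      refine ⟨⟨⟨u, hu⟩, ⟨j - 1, by simp only; omega⟩⟩, ?_⟩
      ext e
      simp only [t', ht, hψ, Nat.sub_add_cancel hj]
    · rintro ⟨⟨⟨u, hu⟩, k⟩, rfl⟩
      have hk : (k : ℕ) < m G o u - 1 := k.2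
      exact ⟨u, k + 1, hu, by omega, by omega, ht _ _⟩
  have hle := finrank_range_le_card (R := ℂ) t'
  rw [Set.finrank, ← hF', Fintype.card_sigma] at hle
  have hfin : FiniteDimensional ℂ F := hF' ▸ FiniteDimensional.span_of_finite ℂ (Set.finite_range t')
  rw [hFK] at hfin
  have hge := card_le_finrank_birthSpace hG hEn (T := Q ∘L dT) (fun ψ v hv => (hQ _ v).2 hv) hε hA
  rw [← hFK] at hge
  have hcard := card_children hG hEn n
  rw [Nat.card_eq_fintype_card (α := Sigma _), Fintype.card_sigma] at hge hcard
  simp only [Fintype.card_fin] at hle hge hcard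
  have hsum : ∑ u : {v : V // G.dist o v ≤ n}, m G o u.1 =
      ∑ u : {v : V // G.dist o v ≤ n}, (m G o u.1 - 1) + Nat.card {v : V // G.dist o v ≤ n} := by
    rw [Nat.card_eq_fintype_card, ← Finset.card_univ, Finset.card_eq_sum_ones,
      ← Finset.sum_add_distrib]
    exact Finset.sum_congr rfl fun u _ => (Nat.sub_add_cancel (one_le_m hdeg u.1)).symm
  omega

end truncated

lemma grover_apply_of_apply_eq_zero {S : lA G →L[ℂ] lA G} (hS : IsShift G S)
    {T : lA G →L[ℂ] lV V} {ψ : lA G} (hT : T ψ = 0) (e : G.Dart) :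
    grover G S T ψ e = -ψ e.symm := by
  have : grover G S T ψ = -S ψ := by simp [grover, hT]
  rw [this, lp.coeFn_neg, Pi.neg_apply, hS]

/-- for a tree with no leaves, the birth part of the cut-off walk
`U^(n)`: (i) `F_{n+1}^(±)` (the span of the flows truncated to `A_{n+1}`, over
`u ∈ V_n`) equals `ker(d_T^(n)) ∩ H^(∓) ∩ 𝒜_{n+1}`; (ii) `U^(n)` acts as `±1` on
`F_{n+1}^(±)`; (iii) `dim F_{n+1}^(±) = |V_{n+1}| − |V_n| − 1`. -/
theorem statement18 {V : Type} (G : SimpleGraph V) [∀ v : V, Fintype (G.neighborSet v)]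
    (hG : G.IsTree) [Infinite V] (o : V)
    (hdeg : ∀ v : V, 2 ≤ G.degree v)
    (En : ∀ u : V, Fin (m G o u) → G.Dart) (hEn : IsChildEnum G o En)
    (Φ : V → ℕ → ℂ → G.Dart → ℂ)
    (hΦ : ∀ (u : V) (j : ℕ) (ε : ℂ), 1 ≤ j → j ≤ m G o u - 1 → (ε = 1 ∨ ε = -1) →
      IsFlow G o En u j ε (Φ u j ε))
    (dT : lA G →L[ℂ] lV V) (S : lA G →L[ℂ] lA G)
    (hdT : IsBoundaryT G dT) (hS : IsShift G S)
    -- `P n` is the orthogonal projection of ℓ²(V) onto functions supported in V_n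
    (P : ℕ → (lV V →L[ℂ] lV V))
    (hP : ∀ (n : ℕ) (f : lV V) (v : V),
      (G.dist o v ≤ n → P n f v = f v) ∧ (¬ G.dist o v ≤ n → P n f v = 0)) :
    ∀ n : ℕ,
    -- the arc set A_{n+1}
    ∀ An1 : Set G.Dart,
      An1 = {e : G.Dart | G.dist o e.fst ≤ n + 1 ∧ G.dist o e.snd ≤ n + 1} →
    -- F_{n+1}^(+) and F_{n+1}^(−): spans of the flows truncated to A_{n+1}
    ∀ Fp Fm : Submodule ℂ (lA G),
      Fp = Submodule.span ℂ {ψ : lA G | ∃ (u : V) (j : ℕ), G.dist o u ≤ n ∧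
          1 ≤ j ∧ j ≤ m G o u - 1 ∧
          ∀ e : G.Dart, ψ e = if e ∈ An1 then Φ u j 1 e else 0} →
      Fm = Submodule.span ℂ {ψ : lA G | ∃ (u : V) (j : ℕ), G.dist o u ≤ n ∧
          1 ≤ j ∧ j ≤ m G o u - 1 ∧
          ∀ e : G.Dart, ψ e = if e ∈ An1 then Φ u j (-1) e else 0} →
    -- (i)
    ((∀ ψ : lA G, ψ ∈ Fp ↔
        ((P n ∘L dT) ψ = 0 ∧ (∀ e : G.Dart, ψ e.symm = -ψ e) ∧
          ψ ∈ suppSubmodule G An1)) ∧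
     (∀ ψ : lA G, ψ ∈ Fm ↔
        ((P n ∘L dT) ψ = 0 ∧ (∀ e : G.Dart, ψ e.symm = ψ e) ∧
          ψ ∈ suppSubmodule G An1))) ∧
    -- (ii)
    ((∀ ψ ∈ Fp, grover G S (P n ∘L dT) ψ = ψ) ∧
     (∀ ψ ∈ Fm, grover G S (P n ∘L dT) ψ = -ψ)) ∧
    -- (iii)
    (Module.finrank ℂ Fp =
        Nat.card {v : V // G.dist o v ≤ n + 1} - Nat.card {v : V // G.dist o v ≤ n} - 1 ∧
     Module.finrank ℂ Fm =
        Nat.card {v : V // G.dist o v ≤ n + 1} - Nat.card {v : V // G.dist o v ≤ n} - 1) := by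
  intro n An1 hAn1 Fp Fm hFp hFm
  obtain ⟨hKp, hdp⟩ := span_truncatedFlow hG hdeg hEn hdT (hP n) (ε := 1) (by norm_num) hAn1
    (fun u j hj hjm => hΦ u j 1 hj hjm (Or.inl rfl)) hFp
  obtain ⟨hKm, hdm⟩ := span_truncatedFlow hG hdeg hEn hdT (hP n) (ε := -1) (by norm_num) hAn1
    (fun u j hj hjm => hΦ u j (-1) hj hjm (Or.inr rfl)) hFm
  have hp (ψ : lA G) : ψ ∈ Fp ↔ ((P n ∘L dT) ψ = 0 ∧ (∀ e : G.Dart, ψ e.symm = -ψ e) ∧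
      ψ ∈ suppSubmodule G An1) := by
    rw [hKp]
    change (_ ∧ (∀ e : G.Dart, ψ e.symm = -1 * ψ e) ∧ _) ↔ _
    simp only [neg_one_mul]
    rfl
  have hm (ψ : lA G) : ψ ∈ Fm ↔ ((P n ∘L dT) ψ = 0 ∧ (∀ e : G.Dart, ψ e.symm = ψ e) ∧
      ψ ∈ suppSubmodule G An1) := by
    rw [hKm]
    change (_ ∧ (∀ e : G.Dart, ψ e.symm = - -1 * ψ e) ∧ _) ↔ _
    simp only [neg_neg, one_mul]
    rfl
  refine ⟨⟨hp, hm⟩, ⟨fun ψ hψ => ?_, fun ψ hψ => ?_⟩, hdp, hdm⟩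
  · obtain ⟨h1, h2, -⟩ := (hp ψ).1 hψ
    ext e
    rw [grover_apply_of_apply_eq_zero G hS h1, h2, neg_neg]
  · obtain ⟨h1, h2, -⟩ := (hm ψ).1 hψ
    ext e
    rw [grover_apply_of_apply_eq_zero G hS h1, h2, lp.coeFn_neg, Pi.neg_apply]

end GroverStmt
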